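/- arXiv:2006.05618 — 2 statements merged into one kernel-verified Lean document; each statement's English description precedes it below -/
import Mathlib

section
/- Let U be a finite-dimensional module over the Lie superalgebra (A#V)_0, where V = W(m,n) or W(m,n) ⋉ A d_0. Then the action of (A#V)_0 on U is polynomial: D_i(f,r) = Σ_{k∈ℤ_+^m} (r^k/k!) d_i(f, k−ε_i), Δ_α(f,r) = Σ_{k∈ℤ_+^m} (r^k/k!) ∂_α(f,k), and D_0(f,r) = Σ_{k∈ℤ_+^m} (r^k/k!) d_0(f,k), where d_i(f,k), ∂_α(f,k), d_0(f,k) ∈ End(U) vanish for all sufficiently large k. -/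
open scoped BigOperators

namespace WSuper

noncomputable section

/-- Exponents of the Laurent (even) variables `t_1, …, t_m`. -/
abbrev LExp (m : ℕ) := Fin m → ℤ
/-- Exponents of the Grassmann (odd) variables `ξ_1, …, ξ_n`. -/
abbrev GExp (n : ℕ) := Fin n → Bool

variable {m n : ℕ}

/-- Degree of a Grassmann monomial `ξ^s`. -/
def gdeg (s : GExp n) : ℕ := (Finset.univ.filter fun a => s a = true).card

/-- Number of inversions between `ξ^s` and `ξ^q`. -/
def invCount (s q : GExp n) : ℕ :=
  ((Finset.univ ×ˢ Finset.univ).filter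
    fun p : Fin n × Fin n => s p.1 = true ∧ q p.2 = true ∧ p.2 < p.1).card

/-- The scalar `c` with `ξ^s · ξ^q = c · ξ^(s xor q)` in the exterior algebra. -/
def mulSgn (s q : GExp n) : ℂ :=
  if ∃ a, s a = true ∧ q a = true then 0 else (-1 : ℂ) ^ invCount s q

/-- Exponent of the product of two (disjoint) Grassmann monomials. -/
def xorE (s q : GExp n) : GExp n := fun a => Bool.xor (s a) (q a)

/-- The scalar `c` with `∂_a (ξ^s) = c ξ^(s \ a)`. -/
def derC (a : Fin n) (s : GExp n) : ℂ :=
  if s a = true then (-1 : ℂ) ^ (Finset.univ.filter fun x => s x = true ∧ x < a).card else 0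

/-- The exponent of `∂_a (ξ^s)`. -/
def derE (a : Fin n) (s : GExp n) : GExp n := Function.update s a false

/-- Directions: `d_i = t_i ∂/∂t_i`, `∂_α = ∂/∂ξ_α`, and (when `b = true`) the extra
even direction `d_0` of `W(m,n) ⋉ A d_0`. -/
inductive Dir (m n : ℕ) : Bool → Type where
  | di {b : Bool} (i : Fin m) : Dir m n b
  | pa {b : Bool} (a : Fin n) : Dir m n b
  | d0 : Dir m n true

/-- The basis `t^r ξ^s D` of `W(m,n)` (for `b = false`) resp. of `W(m,n) ⋉ A d_0`
(for `b = true`). -/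
abbrev WBasis (m n : ℕ) (b : Bool) := LExp m × GExp n × Dir m n b

/-- The Lie superalgebra `W(m,n)` (`b = false`) resp. `W(m,n) ⋉ A d_0` (`b = true`),
as the free complex vector space on its standard basis. -/
abbrev W (m n : ℕ) (b : Bool) := WBasis m n b →₀ ℂ

def sng {b : Bool} (x : WBasis m n b) : W m n b := Finsupp.single x 1

/-- Parity (0 = even, 1 = odd) of a basis element. -/
def par {b : Bool} : WBasis m n b → ℕ
  | ⟨_, s, .di _⟩ => gdeg s % 2
  | ⟨_, s, .pa _⟩ => (gdeg s + 1) % 2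
  | ⟨_, s, .d0⟩ => gdeg s % 2

/-- The super Lie bracket of `W(m,n)` (resp. `W(m,n) ⋉ A d_0`) on basis elements. -/
def brB {b : Bool} : WBasis m n b → WBasis m n b → W m n b
  | ⟨r, s, .di i⟩, ⟨p, q, .di j⟩ =>
      ((p i : ℂ) * mulSgn s q) • sng ⟨r + p, xorE s q, .di j⟩
        - ((r j : ℂ) * mulSgn s q) • sng ⟨r + p, xorE s q, .di i⟩
  | ⟨r, s, .di i⟩, ⟨p, q, .pa β⟩ =>
      ((p i : ℂ) * mulSgn s q) • sng ⟨r + p, xorE s q, .pa β⟩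
        - ((-1 : ℂ) ^ (gdeg s * (gdeg q + 1)) * derC β s * mulSgn q (derE β s)) •
            sng ⟨r + p, xorE q (derE β s), .di i⟩
  | ⟨r, s, .pa α⟩, ⟨p, q, .di j⟩ =>
      (derC α q * mulSgn s (derE α q)) • sng ⟨r + p, xorE s (derE α q), .di j⟩
        - ((-1 : ℂ) ^ ((gdeg s + 1) * gdeg q) * (r j : ℂ) * mulSgn q s) •
            sng ⟨r + p, xorE q s, .pa α⟩
  | ⟨r, s, .pa α⟩, ⟨p, q, .pa β⟩ =>
      (derC α q * mulSgn s (derE α q)) • sng ⟨r + p, xorE s (derE α q), .pa β⟩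
        - ((-1 : ℂ) ^ ((gdeg s + 1) * (gdeg q + 1)) * derC β s * mulSgn q (derE β s)) •
            sng ⟨r + p, xorE q (derE β s), .pa α⟩
  | ⟨r, s, .di i⟩, ⟨p, q, .d0⟩ =>
      ((p i : ℂ) * mulSgn s q) • sng ⟨r + p, xorE s q, .d0⟩
  | ⟨r, s, .pa α⟩, ⟨p, q, .d0⟩ =>
      (derC α q * mulSgn s (derE α q)) • sng ⟨r + p, xorE s (derE α q), .d0⟩
  | ⟨r, s, .d0⟩, ⟨p, q, .di j⟩ =>
      (-(r j : ℂ) * mulSgn s q) • sng ⟨r + p, xorE s q, .d0⟩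
  | ⟨r, s, .d0⟩, ⟨p, q, .pa β⟩ =>
      (-(-1 : ℂ) ^ (gdeg s * (gdeg q + 1)) * derC β s * mulSgn q (derE β s)) •
          sng ⟨r + p, xorE q (derE β s), .d0⟩
  | ⟨_, _, .d0⟩, ⟨_, _, .d0⟩ => 0

/-- A module over the Lie superalgebra `W(m,n)` (resp. `W(m,n) ⋉ A d_0`):
a complex vector space with a linear action satisfying the super commutator rule. -/
structure WRep (m n : ℕ) (b : Bool) where
  M : Type
  [addgrp : AddCommGroup M]
  [mods : Module ℂ M]
  act : W m n b →ₗ[ℂ] M →ₗ[ℂ] M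
  super : ∀ x y : WBasis m n b,
    act (brB x y)
      = act (sng x) ∘ₗ act (sng y)
        - ((-1 : ℂ) ^ (par x * par y)) • (act (sng y) ∘ₗ act (sng x))

attribute [instance] WRep.addgrp WRep.mods

/-- A raw action of (the basis of) `W(m,n)` resp. `W(m,n) ⋉ A d_0` on a vector space. -/
abbrev GAct (m n : ℕ) (b : Bool) (M : Type) [AddCommGroup M] [Module ℂ M] :=
  WBasis m n b → M →ₗ[ℂ] M

/-- Index set for the Cartan subalgebra `h'`: the elements `d_1, …, d_m`,
together with `d_0` when `b = true`. -/
abbrev HIdx (m : ℕ) (b : Bool) := Fin m ⊕ Fin (cond b 1 0)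

def hB (m n : ℕ) (b : Bool) : HIdx m b → WBasis m n b :=
  fun h => match b, h with
    | _, .inl i => ⟨0, fun _ => false, .di i⟩
    | true, .inr _ => ⟨0, fun _ => false, .d0⟩
    | false, .inr j => j.elim0

/-- The basis element `ξ_a ∂_a` of the odd Cartan subalgebra `h''`. -/
def hppB (m n : ℕ) (b : Bool) (a : Fin n) : WBasis m n b :=
  ⟨0, fun x => decide (x = a), .pa a⟩

section Predicates

variable {M : Type} [AddCommGroup M] [Module ℂ M] {b : Bool}

/-- Weight space with respect to the even Cartan subalgebra `h'`. -/
def wtG (F : GAct m n b M) (lam : HIdx m b → ℂ) : Submodule ℂ M :=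
  ⨅ h, LinearMap.ker (F (hB m n b h) - lam h • (LinearMap.id : M →ₗ[ℂ] M))

/-- Weight space with respect to the full Cartan subalgebra `h = h' ⊕ h''`. -/
def wtFullG (F : GAct m n b M) (lam : HIdx m b → ℂ) (mu : Fin n → ℂ) : Submodule ℂ M :=
  wtG F lam ⊓
    ⨅ a, LinearMap.ker (F (hppB m n b a) - mu a • (LinearMap.id : M →ₗ[ℂ] M))

/-- Strong Harish-Chandra module: weight decomposition with respect to `h'`
with finite-dimensional weight spaces. -/
def IsStrongHCG (F : GAct m n b M) : Prop :=
  (⨆ lam, wtG F lam) = ⊤ ∧ ∀ lam, FiniteDimensional ℂ (wtG F lam)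

/-- Harish-Chandra module: weight decomposition with respect to `h`
with finite-dimensional weight spaces. -/
def IsHCG (F : GAct m n b M) : Prop :=
  (⨆ lam, ⨆ mu, wtFullG F lam mu) = ⊤ ∧
    ∀ lam mu, FiniteDimensional ℂ (wtFullG F lam mu)

/-- Strongly cuspidal: strong Harish-Chandra with uniformly bounded multiplicities. -/
def IsStronglyCuspidalG (F : GAct m n b M) : Prop :=
  IsStrongHCG F ∧ ∃ C : ℕ, ∀ lam, Module.finrank ℂ (wtG F lam) ≤ C

/-- Cuspidal: Harish-Chandra with uniformly bounded weight multiplicities. -/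
def IsCuspidalG (F : GAct m n b M) : Prop :=
  IsHCG F ∧ ∃ C : ℕ, ∀ lam mu, Module.finrank ℂ (wtFullG F lam mu) ≤ C

/-- The action of the odd Cartan subalgebra `h''` is diagonalizable. -/
def DiagHppG (F : GAct m n b M) : Prop :=
  (⨆ mu : Fin n → ℂ,
    ⨅ a, LinearMap.ker (F (hppB m n b a) - mu a • (LinearMap.id : M →ₗ[ℂ] M))) = ⊤

def InvariantG (F : GAct m n b M) (N : Submodule ℂ M) : Prop :=
  ∀ x : WBasis m n b, ∀ v ∈ N, F x v ∈ N

/-- Simplicity of a module, phrased via invariant subspaces. -/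
def IsSimpleG (F : GAct m n b M) : Prop :=
  (∃ v : M, v ≠ 0) ∧ ∀ N : Submodule ℂ M, InvariantG F N → N = ⊥ ∨ N = ⊤

end Predicates

/-- The action of basis elements attached to a representation. -/
def WRep.g {b : Bool} (ρ : WRep m n b) : GAct m n b ρ.M := fun x => ρ.act (sng x)

end

end WSuper

namespace WSuper

noncomputable section

variable {m n : ℕ}

/-- Basis monomials `t^r ξ^s` of the supercommutative superalgebra `A = R_m ⊗ Λ`. -/
abbrev ABasis (m n : ℕ) := LExp m × GExp n

/-- The supercommutative superalgebra `A = R_m ⊗ Λ` as the free complex vector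
space on its monomial basis. -/
abbrev AAlg (m n : ℕ) := ABasis m n →₀ ℂ

def asng (x : ABasis m n) : AAlg m n := Finsupp.single x 1

def aone (m n : ℕ) : AAlg m n := asng (0, fun _ => false)

/-- Product of two monomials of `A`. -/
def amulB (x y : ABasis m n) : AAlg m n :=
  mulSgn x.2 y.2 • asng (x.1 + y.1, xorE x.2 y.2)

/-- Parity of a monomial of `A`. -/
def apar (x : ABasis m n) : ℕ := gdeg x.2 % 2

/-- The action of a basis element of `W(m,n)` (resp. `W(m,n) ⋉ A d_0`) on a
monomial of `A` by superderivations (`d_0` acts by zero on `A`). -/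
def wOnA {b : Bool} : WBasis m n b → ABasis m n → AAlg m n
  | ⟨r, s, .di i⟩, ⟨p, q⟩ => ((p i : ℂ) * mulSgn s q) • asng (r + p, xorE s q)
  | ⟨r, s, .pa α⟩, ⟨p, q⟩ =>
      (derC α q * mulSgn s (derE α q)) • asng (r + p, xorE s (derE α q))
  | ⟨_, _, .d0⟩, _ => 0

/-- An `AV`-module: compatible actions of the superalgebra `A` and of the Lie
superalgebra `V = W(m,n)` (resp. `W(m,n) ⋉ A d_0`), satisfying the Leibniz rule. -/
structure AVRep (m n : ℕ) (b : Bool) extends WRep m n b where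
  aact : AAlg m n →ₗ[ℂ] M →ₗ[ℂ] M
  aact_one : aact (aone m n) = LinearMap.id
  aact_mul : ∀ x y : ABasis m n, aact (amulB x y) = aact (asng x) ∘ₗ aact (asng y)
  leibniz : ∀ (x : WBasis m n b) (f : ABasis m n),
    act (sng x) ∘ₗ aact (asng f)
      = aact (wOnA x f)
        + ((-1 : ℂ) ^ (par x * apar f)) • (aact (asng f) ∘ₗ act (sng x))

/-- `M` is finitely generated as an `A`-module. -/
def IsFiniteRank {b : Bool} (ρ : AVRep m n b) : Prop :=
  ∃ S : Finset ρ.M,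
    Submodule.span ℂ {v : ρ.M | ∃ f : ABasis m n, ∃ s ∈ S, v = ρ.aact (asng f) s} = ⊤

/-- A subspace invariant under both the `A`-action and the `V`-action. -/
def AVInvariant {b : Bool} (ρ : AVRep m n b) (N : Submodule ℂ ρ.M) : Prop :=
  InvariantG ρ.g N ∧ ∀ f : ABasis m n, ∀ v ∈ N, ρ.aact (asng f) v ∈ N

/-- Irreducibility as an `AV`-module. -/
def AVIsSimple {b : Bool} (ρ : AVRep m n b) : Prop :=
  (∃ v : ρ.M, v ≠ 0) ∧ ∀ N : Submodule ℂ ρ.M, AVInvariant ρ N → N = ⊥ ∨ N = ⊤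

/-- A weight module: weight decomposition with respect to `h'`. -/
def IsWeightG {M : Type} [AddCommGroup M] [Module ℂ M] {b : Bool}
    (F : GAct m n b M) : Prop :=
  (⨆ lam, wtG F lam) = ⊤

end

end WSuper

namespace WSuper

noncomputable section

variable {m n : ℕ}

/-- Basis elements `f D(g, r) = t^{-r} f ⊗ t^r g D` (with `f, g` Grassmann
monomials, `r ∈ ℤ^m`, `D` a direction) of the degree-zero Lie superalgebra
`(A # V)_0` of the smash product. -/
abbrev SBasis (m n : ℕ) (b : Bool) := GExp n × GExp n × LExp m × Dir m n b

/-- The degree-zero component `(A # V)_0` of the Lie superalgebra `A # V`,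
as the free complex vector space on its basis. -/
abbrev SAlg (m n : ℕ) (b : Bool) := SBasis m n b →₀ ℂ

def ssng {b : Bool} (x : SBasis m n b) : SAlg m n b := Finsupp.single x 1

/-- Parity of a basis element of `(A # V)_0`. -/
def spar {b : Bool} : SBasis m n b → ℕ
  | ⟨f, g, _, .di _⟩ => (gdeg f + gdeg g) % 2
  | ⟨f, g, _, .pa _⟩ => (gdeg f + gdeg g + 1) % 2
  | ⟨f, g, _, .d0⟩ => (gdeg f + gdeg g) % 2

/-- The Lie superbracket of `(A # V)_0` on basis elements, obtained from the
smash product bracket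
`[f⊗η, g⊗τ] = f η(g) ⊗ τ − (−1)^{(|f|+|η|)(|g|+|τ|)} g τ(f) ⊗ η + (−1)^{|η||g|} fg ⊗ [η,τ]`. -/
def sbr {b : Bool} : SBasis m n b → SBasis m n b → SAlg m n b
  | ⟨f, g, r, D⟩, ⟨f', g', p, D'⟩ =>
      ((wOnA (⟨r, g, D⟩ : WBasis m n b) (-p, f')).sum fun ue c =>
          (c * mulSgn f ue.2) • ssng (xorE f ue.2, g', p, D'))
      - ((-1 : ℂ) ^ ((gdeg f + par (⟨r, g, D⟩ : WBasis m n b)) *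
            (gdeg f' + par (⟨p, g', D'⟩ : WBasis m n b)))) •
          ((wOnA (⟨p, g', D'⟩ : WBasis m n b) (-r, f)).sum fun ue c =>
            (c * mulSgn f' ue.2) • ssng (xorE f' ue.2, g, r, D))
      + ((-1 : ℂ) ^ (par (⟨r, g, D⟩ : WBasis m n b) * gdeg f')) •
          ((brB (⟨r, g, D⟩ : WBasis m n b) ⟨p, g', D'⟩).sum fun wb c =>
            (c * mulSgn f f') • ssng (xorE f f', wb.2.1, wb.1, wb.2.2))

/-- A module over the Lie superalgebra `(A # V)_0`. -/
structure SRep (m n : ℕ) (b : Bool) where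
  U : Type
  [addgrp : AddCommGroup U]
  [mods : Module ℂ U]
  act : SAlg m n b →ₗ[ℂ] U →ₗ[ℂ] U
  super : ∀ x y : SBasis m n b,
    act (sbr x y)
      = act (ssng x) ∘ₗ act (ssng y)
        - ((-1 : ℂ) ^ (spar x * spar y)) • (act (ssng y) ∘ₗ act (ssng x))

attribute [instance] SRep.addgrp SRep.mods

/-- The exterior algebra `Λ = Λ(ξ_1, …, ξ_n)` as free vector space on its
monomial basis. -/
abbrev LamAlg (n : ℕ) := GExp n →₀ ℂ

def lm (s : GExp n) : LamAlg n := Finsupp.single s 1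

/-- Product in `Λ`. -/
def lmul (f g : LamAlg n) : LamAlg n :=
  f.sum fun s a => g.sum fun q c => (a * c * mulSgn s q) • lm (xorE s q)

/-- The derivation `∂_α` of `Λ`. -/
def pdL (α : Fin n) (f : LamAlg n) : LamAlg n :=
  f.sum fun s a => (a * derC α s) • lm (derE α s)

/-- The (Λ-valued) action of a basis element of `(A # V)_0` on a monomial of `Λ`. -/
def sOnL {b : Bool} : SBasis m n b → GExp n → LamAlg n
  | ⟨F, G, _, .pa α⟩, c =>
      (derC α c * mulSgn G (derE α c) * mulSgn F (xorE G (derE α c))) •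
        lm (xorE F (xorE G (derE α c)))
  | ⟨_, _, _, .di _⟩, _ => 0
  | ⟨_, _, _, .d0⟩, _ => 0

/-- A module over the algebra of differential operators `D(Λ, (A#V)_0)`:
compatible actions of `Λ` and of `(A # V)_0`. -/
structure DSRep (m n : ℕ) (b : Bool) extends SRep m n b where
  lact : LamAlg n →ₗ[ℂ] U →ₗ[ℂ] U
  lact_one : lact (lm (fun _ => false)) = LinearMap.id
  lact_mul : ∀ s q : GExp n, lact (lmul (lm s) (lm q)) = lact (lm s) ∘ₗ lact (lm q)
  compat1 : ∀ (x : SBasis m n b) (f : GExp n),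
    act (ssng x) ∘ₗ lact (lm f)
      = lact (sOnL x f)
        + ((-1 : ℂ) ^ (spar x * gdeg f)) • (lact (lm f) ∘ₗ act (ssng x))
  compat2 : ∀ (f : GExp n) (x : SBasis m n b),
    lact (lm f) ∘ₗ act (ssng x)
      = mulSgn f x.1 • act (ssng (xorE f x.1, x.2.1, x.2.2.1, x.2.2.2))

/-- The shift `ε_i` occurring in the polynomial expansion of `D_i(f, r)`. -/
def dsh {b : Bool} (D : Dir m n b) (j : Fin m) : ℤ :=
  match D with
  | .di i => if j = i then 1 else 0
  | _ => 0

/-- `ε_i` as an integer vector. -/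
def epsZ (i : Fin m) : Fin m → ℤ := fun j => if j = i then 1 else 0

end

end WSuper

namespace WSuper


theorem fwdDiff_iter_succ_apply {E : Type*} [AddCommGroup E] (F : ℤ → E) (k : ℕ) (s : ℤ) :
    (fwdDiff 1)^[k + 1] F s = (fwdDiff 1)^[k] F (s + 1) - (fwdDiff 1)^[k] F s := by
  rw [Function.iterate_succ_apply', fwdDiff]

/-- If `T` acts on the values of `F` like a vector field, then it acts on iterated forward
differences by the discrete Leibniz rule. -/
theorem map_fwdDiff_iter_succ {E : Type*} [AddCommGroup E] [Module ℂ E]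
    (T : E →ₗ[ℂ] E) (q c : ℤ) (F : ℤ → E) (g : E)
    (h : ∀ s : ℤ, T (F s) = s • (F (s + q) - F s) - (c * q) • (F (s + q) - g))
    (k : ℕ) (s : ℤ) :
    T ((fwdDiff 1)^[k + 1] F s) =
      s • ((fwdDiff 1)^[k + 1] F (s + q) - (fwdDiff 1)^[k + 1] F s)
        + ((k : ℤ) + 1) • ((fwdDiff 1)^[k] F (s + 1 + q) - (fwdDiff 1)^[k] F (s + 1))
        - (c * q) • (fwdDiff 1)^[k + 1] F (s + q) := by
  induction k generalizing s with
  | zero =>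
    simp only [fwdDiff_iter_succ_apply, Function.iterate_zero, id, map_sub, h, add_right_comm s q 1]
    module
  | succ k ih =>
    rw [fwdDiff_iter_succ_apply F (k + 1) s, map_sub, ih, ih]
    simp only [fwdDiff_iter_succ_apply, add_right_comm _ q 1]
    push_cast
    module

/-- The vanishing of a forward difference at one point propagates to the other points. -/
theorem fwdDiff_iter_succ_eq_zero_of_apply_eq_zero {E : Type*} [AddCommGroup E] [Module ℂ E]
    (T : ℤ → E →ₗ[ℂ] E) (c : ℤ) (hc : c = 0 ∨ c = 1) (F G : ℤ → E)
    (h : ∀ q s : ℤ, T q (F s) = s • (F (s + q) - F s) - (c * q) • (F (s + q) - G q))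
    (k : ℕ) (hk : 2 ≤ k) (h0 : (fwdDiff 1)^[k + 1] F (-c) = 0) :
    (fwdDiff 1)^[k + 1] F = 0 := by
  have step := fwdDiff_iter_succ_apply F k
  have leib (q s : ℤ) := map_fwdDiff_iter_succ (T q) q c F (G q) (h q) k s
  set w := (fwdDiff 1)^[k + 1] F
  have key (j q : ℤ) (hj : w j = 0) :
      ((k : ℤ) + 1 + j - c * q) • w (j + q) + (c * (q - 1) - j) • w (j + q - 1) = 0 := by
    have h1 := leib q j
    have h2 := leib (q - 1) j
    have h3 := step (j + q)
    rw [hj, map_zero] at h1 h2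
    rw [show j + 1 + q = j + q + 1 by ring] at h1
    rw [show j + 1 + (q - 1) = j + q by ring, ← add_sub_assoc] at h2
    have h4 := h1.symm.trans h2
    rw [← sub_eq_zero] at h4
    rw [← h4, h3]
    module
  have cancel (a : ℤ) (x : E) (ha : a ≠ 0) (hx : a • x = 0) : x = 0 := by
    rw [← Int.cast_smul_eq_zsmul ℂ] at hx
    exact (smul_eq_zero.mp hx).resolve_left (by exact_mod_cast ha)
  suffices hz : ∀ p, w p = 0 from funext hz
  intro p
  rcases hc with rfl | rfl
  · have := key 0 p (by simpa using h0)
    simp only [zero_mul, add_zero, sub_zero, zero_add, zero_smul] at this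
    exact cancel _ _ (by omega) this
  · have w0 : w 0 = 0 := by
      have := key (-1) 1 h0
      rw [neg_add_cancel, zero_sub, h0, smul_zero, add_zero] at this
      exact cancel _ _ (by omega) this
    induction p with
    | zero => exact w0
    | succ p ih =>
      have := key p 1 ih
      simp only [add_sub_cancel_right, ih] at this
      rw [smul_zero, add_zero] at this
      exact cancel _ _ (by omega) this
    | pred p ih =>
      have := key 0 (-p) w0
      rw [zero_add, ih, smul_zero, zero_add] at this
      exact cancel _ _ (by omega) this

theorem eventually_fwdDiff_iter_eq_zero {E : Type*} [AddCommGroup E] [Module ℂ E]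
    [FiniteDimensional ℂ E] (T : ℤ → E →ₗ[ℂ] E) (c : ℤ) (hc : c = 0 ∨ c = 1) :
    ∀ᶠ N in Filter.atTop, ∀ F G : ℤ → E,
      (∀ q s : ℤ, T q (F s) = s • (F (s + q) - F s) - (c * q) • (F (s + q) - G q)) →
        (fwdDiff 1)^[N] F = 0 := by
  have hev : ∀ᶠ k : ℕ in Filter.atTop,
      ¬ Module.End.HasEigenvalue (T (-1)) ((c - (k + 1 : ℤ) : ℤ) : ℂ) := by
    rw [← Nat.cofinite_eq_atTop, Filter.eventually_cofinite]
    simp only [not_not]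
    refine (Module.End.finite_hasEigenvalue (T (-1))).preimage
      (f := fun k : ℕ => ((c - (k + 1 : ℤ) : ℤ) : ℂ)) (fun a _ b _ hab => ?_)
    have : (c - (a + 1 : ℤ) : ℤ) = c - (b + 1 : ℤ) := Int.cast_injective (α := ℂ) hab
    omega
  rw [← Filter.map_add_atTop_eq_nat 1, Filter.eventually_map]
  filter_upwards [hev, Filter.eventually_ge_atTop 2] with k hk hk2 F G h
  refine fwdDiff_iter_succ_eq_zero_of_apply_eq_zero T c hc F G h k hk2 ?_
  by_contra hne
  refine hk (Module.End.hasEigenvalue_of_hasEigenvector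
    (Module.End.hasEigenvector_iff.mpr ⟨Module.End.mem_eigenspace_iff.mpr ?_, hne⟩))
  rw [map_fwdDiff_iter_succ (T (-1)) (-1) c F (G (-1)) (h (-1)) k (-c), Int.cast_smul_eq_zsmul,
    show -c + 1 + -1 = -c by ring,
    fwdDiff_iter_succ_apply F k (-c)]
  module

/-- Newton's formula for a sequence on `ℤ` killed by an iterated forward difference. -/
theorem eq_sum_choose_smul_fwdDiff_iter {E : Type*} [AddCommGroup E] [Module ℂ E]
    (N : ℕ) (F : ℤ → E) (h : (fwdDiff 1)^[N] F = 0) (r : ℤ) :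
    F r = ∑ k ∈ Finset.range N, Ring.choose (r : ℂ) k • (fwdDiff 1)^[k] F 0 := by
  induction N generalizing F r with
  | zero => simpa using congrFun h r
  | succ N ih =>
    have hd (s : ℤ) : F (s + 1) - F s =
        ∑ k ∈ Finset.range N, Ring.choose (s : ℂ) k • (fwdDiff 1)^[k + 1] F 0 :=
      ih (fwdDiff 1 F) h s
    have hs (s : ℤ) : ∑ k ∈ Finset.range (N + 1),
        Ring.choose ((s + 1 : ℤ) : ℂ) k • (fwdDiff 1)^[k] F 0 =
        (∑ k ∈ Finset.range (N + 1), Ring.choose (s : ℂ) k • (fwdDiff 1)^[k] F 0)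
          + (F (s + 1) - F s) := by
      rw [hd, Finset.sum_range_succ', Finset.sum_range_succ' _ N, add_right_comm,
        ← Finset.sum_add_distrib]
      simp only [Int.cast_add, Int.cast_one, Ring.choose_succ_succ, Ring.choose_zero_right,
        add_smul, add_comm]
    induction r with
    | zero => simp [Finset.sum_range_succ']
    | succ r ihr => rw [hs, ← ihr]; abel
    | pred r ihr =>
      have := hs (-r - 1)
      rw [sub_add_cancel, ← ihr] at this
      rw [← sub_eq_iff_eq_add.mpr this]; abel

theorem exists_choose_eq_sum_pow (k : ℕ) : ∃ p : ℕ → ℂ, ∀ (N : ℕ), k < N → ∀ r : ℤ,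
    Ring.choose (r : ℂ) k = ∑ l ∈ Finset.range N, (r : ℂ) ^ l * p l := by
  refine ⟨fun l => (k.factorial : ℂ)⁻¹ * (descPochhammer ℂ k).coeff l, fun N hN r => ?_⟩
  rw [Ring.choose_eq_smul, ← Polynomial.aeval_eq_smeval, Polynomial.aeval_def,
    ← Polynomial.eval_map, descPochhammer_map,
    Polynomial.eval_eq_sum_range' (n := N) (by rwa [descPochhammer_natDegree]),
    smul_eq_mul, Finset.mul_sum]
  exact Finset.sum_congr rfl fun l _ => by ring

theorem exists_eq_sum_pow_smul {E : Type*} [AddCommGroup E] [Module ℂ E]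
    (N : ℕ) (F : ℤ → E) (h : (fwdDiff 1)^[N] F = 0) (V : Submodule ℂ E) (hV : ∀ s, F s ∈ V) :
    ∃ a : ℕ → E, (∀ l, a l ∈ V) ∧
      ∀ r : ℤ, F r = ∑ l ∈ Finset.range N, (r : ℂ) ^ l • a l := by
  choose p hp using exists_choose_eq_sum_pow
  refine ⟨fun l => ∑ k ∈ Finset.range N, p k l • (fwdDiff 1)^[k] F 0, fun l => ?_, fun r => ?_⟩
  · refine Submodule.sum_mem _ fun k _ => V.smul_mem _ ?_
    rw [fwdDiff_iter_eq_sum_shift]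
    exact Submodule.sum_mem _ fun j _ => zsmul_mem (hV _) _
  · rw [eq_sum_choose_smul_fwdDiff_iter N F h r]
    simp only [Finset.smul_sum]
    rw [Finset.sum_comm]
    refine Finset.sum_congr rfl fun k hk => ?_
    rw [hp k N (Finset.mem_range.mp hk), Finset.sum_smul]
    simp only [mul_smul]

/-- The functions on `ℤ^m` killed by the `N`-th forward difference in each variable. -/
def fwdDiffKer (m N : ℕ) (E : Type*) [AddCommGroup E] [Module ℂ E] :
    Submodule ℂ ((Fin m → ℤ) → E) where
  carrier := {F | ∀ i u, (fwdDiff 1)^[N] (fun s : ℤ => F (Function.update u i s)) = 0}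
  add_mem' {F G} hF hG i u := by
    have := fwdDiff_iter_add 1 (fun s : ℤ => F (Function.update u i s))
      (fun s => G (Function.update u i s)) N
    rw [hF, hG, add_zero] at this
    exact this
  zero_mem' i u := by
    funext s
    simp [fwdDiff_iter_eq_sum_shift]
  smul_mem' c F hF i u := by
    have := fwdDiff_iter_const_smul 1 c (fun s : ℤ => F (Function.update u i s)) N
    rw [hF, smul_zero] at this
    exact this

theorem exists_eq_sum_prod_pow_smul {E : Type*} [AddCommGroup E] [Module ℂ E] (m N : ℕ)
    (F : (Fin m → ℤ) → E) (hF : F ∈ fwdDiffKer m N E) :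
    ∃ a : (Fin m → ℕ) → E, ∀ r : Fin m → ℤ,
      F r = ∑ k : Fin m → Fin N, (∏ i, (r i : ℂ) ^ (k i : ℕ)) • a (fun i => k i) := by
  induction m with
  | zero =>
    refine ⟨fun _ => F 0, fun r => ?_⟩
    simp [Subsingleton.elim r 0]
  | succ m ih =>
    obtain ⟨A, hA, hsum⟩ := exists_eq_sum_pow_smul N
      (fun s : ℤ => fun r : Fin m → ℤ => F (Fin.cons s r)) (by
        funext s r
        have := congrFun (hF 0 (Fin.cons 0 r)) s
        simp only [Fin.update_cons_zero] at this
        rw [fwdDiff_iter_eq_sum_shift] at this ⊢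
        simpa using this) (fwdDiffKer m N E) (fun s i u => by
        have := hF i.succ (Fin.cons s u)
        simpa only [← Fin.cons_update] using this)
    choose a ha using fun l => ih (A l) (hA l)
    refine ⟨fun k => a (k 0) (fun i => k i.succ), fun r => ?_⟩
    have h1 := congrFun (hsum (r 0)) (fun i => r i.succ)
    change F (Fin.cons (r 0) (Fin.tail r)) = _ at h1
    rw [Fin.cons_self_tail] at h1
    rw [h1, ← (Fin.consEquiv fun _ => Fin N).sum_comp, Fintype.sum_prod_type, Finset.sum_apply,
      ← Fin.sum_univ_eq_sum_range (fun l => ((r 0 : ℂ) ^ l • A l) fun i => r i.succ)]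
    refine Finset.sum_congr rfl fun l _ => ?_
    rw [Pi.smul_apply, ha, Finset.smul_sum]
    refine Finset.sum_congr rfl fun k _ => ?_
    simp [Fin.prod_univ_succ, mul_smul, Fin.consEquiv]


/-- The coordinate of `p` along the direction `D`. -/
def dirCoeff {m n : ℕ} {b : Bool} (D : Dir m n b) (p : LExp m) : ℤ :=
  match D with
  | .di j => p j
  | _ => 0

theorem mulSgn_one_left {n : ℕ} (g : GExp n) : mulSgn (fun _ => false) g = 1 := by
  simp [mulSgn, invCount]

theorem mulSgn_one_right {n : ℕ} (g : GExp n) : mulSgn g (fun _ => false) = 1 := by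
  simp [mulSgn, invCount]

theorem xorE_one_left {n : ℕ} (g : GExp n) : xorE (fun _ => false) g = g := by
  funext a
  simp [xorE]

theorem xorE_one_right {n : ℕ} (g : GExp n) : xorE g (fun _ => false) = g := by
  funext a
  simp [xorE]

theorem gdeg_one {n : ℕ} : gdeg (fun _ : Fin n => false) = 0 := by
  simp [gdeg]

theorem derC_one {n : ℕ} (a : Fin n) : derC a (fun _ => false) = 0 := by
  simp [derC]

theorem sbr_di_one {m n : ℕ} {b : Bool} (i : Fin m) (p : LExp m) (g : GExp n) (s : LExp m)
    (D : Dir m n b) :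
    sbr (fun _ => false, fun _ => false, p, .di i) (fun _ => false, g, s, D) =
      (s i : ℂ) • (ssng (fun _ => false, g, p + s, D) - ssng (fun _ => false, g, s, D))
        - (dirCoeff D p : ℂ) • (ssng (fun _ => false, g, p + s, .di i)
          - ssng (g, fun _ => false, p, .di i)) := by
  have hsub (x y : W m n b) :
      (x - y).sum (fun wb c => c • (ssng (fun _ => false, wb.2.1, wb.1, wb.2.2) : SAlg m n b)) =
        x.sum (fun wb c => c • ssng (fun _ => false, wb.2.1, wb.1, wb.2.2))
          - y.sum (fun wb c => c • ssng (fun _ => false, wb.2.1, wb.1, wb.2.2)) :=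
    Finsupp.sum_sub_index fun _ _ _ => sub_smul _ _ _
  cases D <;>
    simp [sbr, wOnA, brB, par, dirCoeff, mulSgn_one_left, mulSgn_one_right, xorE_one_left,
      xorE_one_right, gdeg_one, derC_one, asng, sng, hsub, ← Finsupp.single_neg] <;>
    module

theorem SRep.act_di_one_commutator {m n : ℕ} {b : Bool} (σ : SRep m n b) (i : Fin m)
    (p : LExp m) (g : GExp n) (s : LExp m) (D : Dir m n b) :
    (LinearMap.mulLeft ℂ (σ.act (ssng (fun _ => false, fun _ => false, p, .di i)))
      - LinearMap.mulRight ℂ (σ.act (ssng (fun _ => false, fun _ => false, p, .di i))) :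
        Module.End ℂ (Module.End ℂ σ.U)) (σ.act (ssng (fun _ => false, g, s, D))) =
      s i • (σ.act (ssng (fun _ => false, g, p + s, D)) - σ.act (ssng (fun _ => false, g, s, D)))
        - dirCoeff D p • (σ.act (ssng (fun _ => false, g, p + s, .di i))
          - σ.act (ssng (g, fun _ => false, p, .di i))) := by
  have h := σ.super (fun _ => false, fun _ => false, p, .di i) (fun _ => false, g, s, D)
  rw [sbr_di_one, show spar (fun _ => false, fun _ => false, p, (.di i : Dir m n b)) = 0 by
    simp [spar, gdeg_one], zero_mul, pow_zero, one_smul] at h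
  rw [LinearMap.sub_apply, LinearMap.mulLeft_apply, LinearMap.mulRight_apply,
    Module.End.mul_eq_comp, Module.End.mul_eq_comp, ← h]
  simp only [map_sub, map_zsmul, Int.cast_smul_eq_zsmul]

theorem SRep.eventually_mem_fwdDiffKer {m n : ℕ} {b : Bool} (σ : SRep m n b)
    [FiniteDimensional ℂ σ.U] :
    ∀ᶠ N in Filter.atTop, ∀ (D : Dir m n b) (g : GExp n),
      (fun r => σ.act (ssng (fun _ => false, g, r, D))) ∈
        fwdDiffKer m N (σ.U →ₗ[ℂ] σ.U) := by
  classical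
  let T (i : Fin m) (q : ℤ) : Module.End ℂ (Module.End ℂ σ.U) :=
    LinearMap.mulLeft ℂ
        (σ.act (ssng (fun _ => false, fun _ => false, Pi.single i q, .di i)))
      - LinearMap.mulRight ℂ
        (σ.act (ssng (fun _ => false, fun _ => false, Pi.single i q, .di i)))
  have h0 := Filter.eventually_all.mpr fun i : Fin m =>
    eventually_fwdDiff_iter_eq_zero (T i) 0 (Or.inl rfl)
  have h1 := Filter.eventually_all.mpr fun i : Fin m =>
    eventually_fwdDiff_iter_eq_zero (T i) 1 (Or.inr rfl)
  have hup (i : Fin m) (u : LExp m) (q s : ℤ) :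
      Pi.single i q + Function.update u i s = Function.update u i (s + q) := by
    funext j
    rcases eq_or_ne j i with rfl | hj
    · simp [add_comm]
    · simp [hj]
  filter_upwards [h0, h1] with N h0 h1 D g i u
  have comm (q s : ℤ) := σ.act_di_one_commutator i (Pi.single i q) g (Function.update u i s) D
  simp only [hup, Function.update_self] at comm
  by_cases hD : D = .di i
  · subst hD
    refine h1 i _ (fun q => σ.act (ssng (g, fun _ => false, Pi.single i q, .di i)))
      fun q s => (comm q s).trans ?_
    simp [dirCoeff]
  · have hz (q : ℤ) : dirCoeff D (Pi.single i q) = 0 := by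
      cases D with
      | di j => exact Pi.single_eq_of_ne (M := fun _ => ℤ) (fun hj => hD (congrArg Dir.di hj)) q
      | pa a => rfl
      | d0 => rfl
    refine h0 i _ (fun _ => 0) fun q s => (comm q s).trans ?_
    simp [hz]

/-- Let `U` be a finite-dimensional module over the Lie
superalgebra `(A#V)_0`, where `V = W(m,n)` (`b = false`) or `W(m,n) ⋉ A d_0`
(`b = true`).  Then the action of `(A#V)_0` on `U` is polynomial:
`D_i(f,r) = Σ_{k ∈ ℤ_+^m} (r^k/k!) d_i(f, k−ε_i)`,
`Δ_α(f,r) = Σ_{k ∈ ℤ_+^m} (r^k/k!) ∂_α(f, k)` and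
`D_0(f,r) = Σ_{k ∈ ℤ_+^m} (r^k/k!) d_0(f, k)`,
where the coefficient operators vanish for all sufficiently large `k`
(so only `k` in a box `{0,…,N}^m` contribute). -/
theorem action_is_polynomial (m n : ℕ) (b : Bool) (σ : SRep m n b)
    (hfin : FiniteDimensional ℂ σ.U) :
    ∃ (N : ℕ) (c : Dir m n b → GExp n → (Fin m → ℤ) → (σ.U →ₗ[ℂ] σ.U)),
      -- the coefficient operators vanish for `k ≫ 0`
      (∀ (D : Dir m n b) (f : GExp n) (k : Fin m → ℤ),
        (∃ i, (N : ℤ) < k i + dsh D i) → c D f k = 0) ∧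
      -- polynomial expansion of the action
      (∀ (D : Dir m n b) (f : GExp n) (r : LExp m),
        σ.act (ssng (fun _ => false, f, r, D))
          = ∑ k : Fin m → Fin (N + 1),
              ((∏ i, (r i : ℂ) ^ (k i : ℕ)) / (∏ i, ((Nat.factorial (k i)) : ℂ))) •
                c D f (fun i => ((k i : ℕ) : ℤ) - dsh D i)) := by
  obtain ⟨N, hN⟩ := (Filter.eventually_atTop.mp σ.eventually_mem_fwdDiffKer).imp
    fun N h => h (N + 1) (Nat.le_succ N)
  choose a ha using fun D g => exists_eq_sum_prod_pow_smul m (N + 1) _ (hN D g)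
  classical
  refine ⟨N, fun D f k => if ∃ i, (N : ℤ) < k i + dsh D i then 0 else
    (∏ i, ((k i + dsh D i).toNat.factorial : ℂ)) • a D f (fun i => (k i + dsh D i).toNat),
    fun D f k hk => if_pos hk, fun D f r => (ha D f r).trans ?_⟩
  refine Finset.sum_congr rfl fun k _ => ?_
  have hk : ¬ ∃ i, (N : ℤ) < ((k i : ℕ) : ℤ) := by
    rintro ⟨i, hi⟩
    have := (k i).isLt
    omega
  have hfac : (∏ i, ((k i : ℕ).factorial : ℂ)) ≠ 0 :=
    Finset.prod_ne_zero_iff.mpr fun i _ => by exact_mod_cast Nat.factorial_ne_zero _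
  simp only [sub_add_cancel, if_neg hk, Int.toNat_natCast, smul_smul, div_mul_cancel₀ _ hfac]

end WSuper
end

section
/- As a Λ-module, the quotient Lie superalgebra L/J is generated by three supercommuting subalgebras: (1) the central ideal spanned by {d_i(1,−ε_i), d_0(1,0)}; (2) the abelian subalgebra spanned by {∂_α(1,0)}; and (3) a subalgebra isomorphic to gl(m,n) spanned by e_{ij} = d_j(1,ε_i−ε_j), e_{αβ} = ∂_β(ξ_α,0) − ξ_α∂_β(1,0), e_{iβ} = ∂_β(1,ε_i), and e_{αj} = d_j(ξ_α,−ε_j) − ξ_α d_j(1,−ε_j), for i,j = 1,…,m and α,β = 1,…,n. -/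
open scoped BigOperators

namespace WSuper

noncomputable section

variable {m n : ℕ}

/-- The right derivation `(f)∂*_β = (−1)^{|f|+1} ∂_β(f)` of `Λ`. -/
def rdL (β : Fin n) (f : LamAlg n) : LamAlg n :=
  f.sum fun s a => (a * (-1 : ℂ) ^ (gdeg s + 1) * derC β s) • lm (derE β s)

/-- `ε_j` as a natural-number vector. -/
def natE (j : Fin m) : Fin m → ℕ := fun x => if x = j then 1 else 0

/-- The trivial Grassmann exponent (the monomial `1`). -/
def gl0 {n : ℕ} : GExp n := fun _ => false

/-- The Grassmann exponent of the single variable `ξ_β`. -/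
def gOne (β : Fin n) : GExp n := fun x => decide (x = β)

/-- Basis of the jet Lie superalgebra `L`: the element `(a, s, kk, D)` represents
`ξ^a D(ξ^s, kk − ε_i)` for `D = d_i`, resp. `ξ^a ∂_α(ξ^s, kk)`, `ξ^a d_0(ξ^s, kk)`;
here `kk ∈ ℤ_+^m`. -/
abbrev LBasis (m n : ℕ) (b : Bool) := GExp n × GExp n × (Fin m → ℕ) × Dir m n b

/-- The jet Lie superalgebra `L`, as free complex vector space on its basis. -/
abbrev LAlg (m n : ℕ) (b : Bool) := LBasis m n b →₀ ℂ

def lsng {b : Bool} (x : LBasis m n b) : LAlg m n b := Finsupp.single x 1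

/-- Parity of a basis element of `L`. -/
def lpar {b : Bool} : LBasis m n b → ℕ
  | ⟨a, s, _, .di _⟩ => (gdeg a + gdeg s) % 2
  | ⟨a, s, _, .pa _⟩ => (gdeg a + gdeg s + 1) % 2
  | ⟨a, s, _, .d0⟩ => (gdeg a + gdeg s) % 2

/-- The actual (shifted) integer label of a generator of `L`. -/
def zOf {b : Bool} (kk : Fin m → ℕ) (D : Dir m n b) : Fin m → ℤ :=
  fun i => (kk i : ℤ) - dsh D i

/-- The generator `D(ξ^s, k)` of `L` with integer label `k` (zero if the label is
out of range). -/
def mkL {b : Bool} (a s : GExp n) (k : Fin m → ℤ) (D : Dir m n b) : LAlg m n b :=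
  if ∀ i, 0 ≤ k i + dsh D i then
    Finsupp.single (a, s, fun i => (k i + dsh D i).toNat, D) 1
  else 0

/-- Left multiplication of an element of `L` by an element of `Λ` (on the first
Grassmann slot). -/
def lmulL {b : Bool} (h : LamAlg n) (z : LAlg m n b) : LAlg m n b :=
  h.sum fun e c => z.sum fun bz cz =>
    (c * cz * mulSgn e bz.1) • Finsupp.single (xorE e bz.1, bz.2.1, bz.2.2.1, bz.2.2.2) 1

/-- The `Λ`-valued bracket `[D(ξ^s,k), ξ^c]` of a generator of `L` with a
Grassmann monomial (relations (R7)–(R9)). -/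
def genOnL {b : Bool} : (GExp n × (Fin m → ℕ) × Dir m n b) → GExp n → LamAlg n
  | ⟨s, kk, .pa α⟩, c =>
      if kk = 0 then (derC α c * mulSgn s (derE α c)) • lm (xorE s (derE α c)) else 0
  | ⟨_, _, .di _⟩, _ => 0
  | ⟨_, _, .d0⟩, _ => 0

/-- The bracket of two generators of `L` (with trivial left Grassmann factor),
given by relations (R1)–(R6) and the `d_0`-relations. -/
def genBr {b : Bool} :
    (GExp n × (Fin m → ℕ) × Dir m n b) → (GExp n × (Fin m → ℕ) × Dir m n b) →
      LAlg m n b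
  | ⟨s, kk, .di i⟩, ⟨q, kk', .di j⟩ =>
      let l := zOf kk (.di i : Dir m n b)
      let k := zOf kk' (.di j : Dir m n b)
      if kk = 0 ∧ kk' = 0 then 0
      else if kk = 0 then
        ((k i : ℂ) + if i = j then 1 else 0) •
          (mulSgn s q • mkL gl0 (xorE s q) (k - epsZ i) (.di j)
            - mkL s q (k - epsZ i) (.di j))
      else if kk' = 0 then
        (-(-1 : ℂ) ^ (gdeg s * gdeg q)) •
          (((l j : ℂ) + if i = j then 1 else 0) •
            (mulSgn q s • mkL gl0 (xorE q s) (l - epsZ j) (.di i)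
              - mkL q s (l - epsZ j) (.di i)))
      else
        (k i : ℂ) • (mulSgn s q • mkL gl0 (xorE s q) (l + k) (.di j))
          - (l j : ℂ) • (mulSgn s q • mkL gl0 (xorE s q) (l + k) (.di i))
  | ⟨s, kk, .di i⟩, ⟨q, kk', .pa α⟩ =>
      let l := zOf kk (.di i : Dir m n b)
      let k := zOf kk' (.pa α : Dir m n b)
      if kk = 0 then
        (k i : ℂ) • (mulSgn s q • mkL gl0 (xorE s q) (k - epsZ i) (.pa α)
            - mkL s q (k - epsZ i) (.pa α))
          - ((-1 : ℂ) ^ (gdeg s + gdeg q) * derC α s * mulSgn (derE α s) q) •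
              mkL gl0 (xorE (derE α s) q) (k - epsZ i) (.di i)
      else
        (k i : ℂ) • (mulSgn s q • mkL gl0 (xorE s q) (l + k) (.pa α))
          - ((-1 : ℂ) ^ (gdeg s + gdeg q) * derC α s * mulSgn (derE α s) q) •
              mkL gl0 (xorE (derE α s) q) (l + k) (.di i)
  | ⟨s, kk, .pa α⟩, ⟨q, kk', .di i⟩ =>
      let l := zOf kk (.pa α : Dir m n b)
      let k := zOf kk' (.di i : Dir m n b)
      if kk' = 0 then
        (-(-1 : ℂ) ^ ((gdeg s + 1) * gdeg q)) •
          ((l i : ℂ) • (mulSgn q s • mkL gl0 (xorE q s) (l - epsZ i) (.pa α)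
              - mkL q s (l - epsZ i) (.pa α))
            - ((-1 : ℂ) ^ (gdeg q + gdeg s) * derC α q * mulSgn (derE α q) s) •
                mkL gl0 (xorE (derE α q) s) (l - epsZ i) (.di i))
      else
        (-(-1 : ℂ) ^ ((gdeg s + 1) * gdeg q)) •
          ((l i : ℂ) • (mulSgn q s • mkL gl0 (xorE q s) (l + k) (.pa α))
            - ((-1 : ℂ) ^ (gdeg q + gdeg s) * derC α q * mulSgn (derE α q) s) •
                mkL gl0 (xorE (derE α q) s) (l + k) (.di i))
  | ⟨s, kk, .pa α⟩, ⟨q, kk', .pa β⟩ =>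
      (derC α q * mulSgn s (derE α q)) •
          mkL gl0 (xorE s (derE α q)) (zOf kk (.pa α : Dir m n b) + zOf kk' (.pa β : Dir m n b)) (.pa β)
        - ((-1 : ℂ) ^ (gdeg s + 1) * derC β s * mulSgn (derE β s) q) •
            mkL gl0 (xorE (derE β s) q) (zOf kk (.pa α : Dir m n b) + zOf kk' (.pa β : Dir m n b)) (.pa α)
  | ⟨s, kk, .di i⟩, ⟨q, kk', .d0⟩ =>
      let l := zOf kk (.di i : Dir m n true)
      let k := zOf kk' (.d0 : Dir m n true)
      if kk = 0 then
        (k i : ℂ) • (mulSgn s q • mkL gl0 (xorE s q) (k - epsZ i) .d0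
          - mkL s q (k - epsZ i) .d0)
      else (k i : ℂ) • (mulSgn s q • mkL gl0 (xorE s q) (l + k) .d0)
  | ⟨s, kk, .pa α⟩, ⟨q, kk', .d0⟩ =>
      (derC α q * mulSgn s (derE α q)) •
        mkL gl0 (xorE s (derE α q)) (zOf kk (.pa α : Dir m n true) + zOf kk' (.d0 : Dir m n true)) .d0
  | ⟨s, kk, .d0⟩, ⟨q, kk', .di j⟩ =>
      let l := zOf kk (.d0 : Dir m n true)
      let k := zOf kk' (.di j : Dir m n true)
      if kk' = 0 then
        (-(-1 : ℂ) ^ (gdeg s * gdeg q)) •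
          ((l j : ℂ) • (mulSgn q s • mkL gl0 (xorE q s) (l - epsZ j) .d0
            - mkL q s (l - epsZ j) .d0))
      else
        (-(-1 : ℂ) ^ (gdeg s * gdeg q)) •
          ((l j : ℂ) • (mulSgn q s • mkL gl0 (xorE q s) (l + k) .d0))
  | ⟨s, kk, .d0⟩, ⟨q, kk', .pa β⟩ =>
      (-(-1 : ℂ) ^ (gdeg s * (gdeg q + 1)) * derC β s * mulSgn q (derE β s)) •
        mkL gl0 (xorE q (derE β s)) (zOf kk (.d0 : Dir m n true) + zOf kk' (.pa β : Dir m n true)) .d0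
  | ⟨_, _, .d0⟩, ⟨_, _, .d0⟩ => 0

/-- The full Lie superbracket of `L` on basis elements, obtained from the
generator brackets and the `Λ`-module structure via
`[f X, g Y] = f (Xg) Y − (−1)^{(|f|+|X|)(|g|+|Y|)} g (Yf) X + (−1)^{|X||g|} fg [X,Y]`. -/
def lbb {b : Bool} : LBasis m n b → LBasis m n b → LAlg m n b
  | ⟨a, s, kk, D⟩, ⟨a', q, kk', D'⟩ =>
      lmulL (lmul (lm a) (genOnL (s, kk, D) a')) (Finsupp.single (gl0, q, kk', D') 1)
        - ((-1 : ℂ) ^ (lpar (⟨a, s, kk, D⟩ : LBasis m n b) *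
              lpar (⟨a', q, kk', D'⟩ : LBasis m n b))) •
            lmulL (lmul (lm a') (genOnL (q, kk', D') a)) (Finsupp.single (gl0, s, kk, D) 1)
        + ((-1 : ℂ) ^ (lpar (⟨gl0, s, kk, D⟩ : LBasis m n b) * gdeg a')) •
            lmulL (lmul (lm a) (lm a')) (genBr (s, kk, D) (q, kk', D'))

/-- A module over the jet Lie superalgebra `L`. -/
structure LRep (m n : ℕ) (b : Bool) where
  U : Type
  [addgrp : AddCommGroup U]
  [mods : Module ℂ U]
  act : LAlg m n b →ₗ[ℂ] U →ₗ[ℂ] U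
  super : ∀ x y : LBasis m n b,
    act (lbb x y)
      = act (lsng x) ∘ₗ act (lsng y)
        - ((-1 : ℂ) ^ (lpar x * lpar y)) • (act (lsng y) ∘ₗ act (lsng x))

attribute [instance] LRep.addgrp LRep.mods

/-- A module over the algebra of differential operators `D(Λ, L)`: compatible
actions of `Λ` and of `L`. -/
structure DLRep (m n : ℕ) (b : Bool) extends LRep m n b where
  lact : LamAlg n →ₗ[ℂ] U →ₗ[ℂ] U
  lact_one : lact (lm gl0) = LinearMap.id
  lact_mul : ∀ s q : GExp n, lact (lmul (lm s) (lm q)) = lact (lm s) ∘ₗ lact (lm q)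
  compat1 : ∀ (x : LBasis m n b) (f : GExp n),
    act (lsng x) ∘ₗ lact (lm f)
      = lact (lmul (lm x.1) (genOnL (x.2.1, x.2.2.1, x.2.2.2) f))
        + ((-1 : ℂ) ^ (lpar x * gdeg f)) • (lact (lm f) ∘ₗ act (lsng x))
  compat2 : ∀ (f : GExp n) (x : LBasis m n b),
    lact (lm f) ∘ₗ act (lsng x) = act (lmulL (lm f) (lsng x))

/-- Simplicity of an `L`-module. -/
def LRep.IsSimple {b : Bool} (σ : LRep m n b) : Prop :=
  (∃ u : σ.U, u ≠ 0) ∧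
    ∀ N : Submodule ℂ σ.U,
      (∀ x : LBasis m n b, ∀ u ∈ N, σ.act (lsng x) u ∈ N) → N = ⊥ ∨ N = ⊤

/-- Simplicity of a `D(Λ, L)`-module. -/
def DLRep.IsSimple {b : Bool} (σ : DLRep m n b) : Prop :=
  (∃ u : σ.U, u ≠ 0) ∧
    ∀ N : Submodule ℂ σ.U,
      (∀ x : LBasis m n b, ∀ u ∈ N, σ.act (lsng x) u ∈ N) →
      (∀ f : GExp n, ∀ u ∈ N, σ.lact (lm f) u ∈ N) → N = ⊥ ∨ N = ⊤

/-! ### The representations of `L` on the weight spaces of the adjoint module,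
and the ideal `J`. -/

/-- Basis of the weight space `U = Σ_i t^r Λ d_i ⊕ Σ_α t^r Λ ∂_α` of the adjoint
`AV`-module `W(m,n)`. -/
abbrev UExB (m n : ℕ) := GExp n × Dir m n false

abbrev UEx (m n : ℕ) := UExB m n →₀ ℂ

/-- The action of a generator of `L` on the basis of `U` (from the adjoint
module example, with `f d_0` acting as multiplication by `λ_0 f`). -/
def exGen (r : LExp m) (l0 : ℂ) {b : Bool} (s : GExp n) (kk : Fin m → ℕ)
    (D : Dir m n b) (u : UExB m n) : UEx m n :=
  match D, u with
  | .di i, (g, .di j) =>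
      if kk = 0 then ((r i : ℂ) * mulSgn s g) • Finsupp.single (xorE s g, .di j) 1
      else if kk = natE j then (-(mulSgn s g)) • Finsupp.single (xorE s g, .di i) 1
      else 0
  | .di i, (g, .pa α) =>
      if kk = 0 then
        ((r i : ℂ) * mulSgn s g) • Finsupp.single (xorE s g, .pa α) 1
          - ((-1 : ℂ) ^ (gdeg s + gdeg g) * derC α s * mulSgn (derE α s) g) •
              Finsupp.single (xorE (derE α s) g, .di i) 1
      else 0
  | .pa α, (g, .di j) =>
      if kk = 0 then
        (derC α g * mulSgn s (derE α g)) • Finsupp.single (xorE s (derE α g), .di j) 1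
      else if kk = natE j then
        (-(-1 : ℂ) ^ gdeg g * mulSgn s g) • Finsupp.single (xorE s g, .pa α) 1
      else 0
  | .pa α, (g, .pa β) =>
      if kk = 0 then
        (derC α g * mulSgn s (derE α g)) • Finsupp.single (xorE s (derE α g), .pa β) 1
          + ((-1 : ℂ) ^ gdeg s * derC β s * mulSgn (derE β s) g) •
              Finsupp.single (xorE (derE β s) g, .pa α) 1
      else 0
  | .d0, (g, E) =>
      if kk = 0 then (l0 * mulSgn s g) • Finsupp.single (xorE s g, E) 1 else 0

/-- The action of a basis element of `L` on the basis of `U`. -/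
def exActVal (r : LExp m) (l0 : ℂ) {b : Bool} (x : LBasis m n b) (u : UExB m n) :
    UEx m n :=
  (exGen r l0 x.2.1 x.2.2.1 x.2.2.2 u).sum fun ge c =>
    (c * mulSgn x.1 ge.1) • Finsupp.single (xorE x.1 ge.1, ge.2) 1

def exActB (r : LExp m) (l0 : ℂ) {b : Bool} (x : LBasis m n b) :
    UEx m n →ₗ[ℂ] UEx m n :=
  Finsupp.lsum ℂ fun u => LinearMap.toSpanSingleton ℂ (UEx m n) (exActVal r l0 x u)

/-- The representation of `L` on the weight space `U` of the adjoint module. -/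
def exActL (r : LExp m) (l0 : ℂ) {b : Bool} :
    LAlg m n b →ₗ[ℂ] UEx m n →ₗ[ℂ] UEx m n :=
  Finsupp.lsum ℂ fun x =>
    LinearMap.toSpanSingleton ℂ (UEx m n →ₗ[ℂ] UEx m n) (exActB r l0 x)

/-- The ideal `J = ∩_{r, λ_0} J_{r,λ_0}` of `L`, the intersection of the kernels
of the representations on the weight spaces of the adjoint modules. -/
def Jsub (m n : ℕ) (b : Bool) : Submodule ℂ (LAlg m n b) :=
  ⨅ (r : LExp m) (l0 : ℂ), LinearMap.ker (exActL r l0)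

/-! ### Generators of `L/J` -/

/-- Index type for the `Λ`-basis of `L/J`:
`d_i(1,−ε_i)`, `d_i(ξ_β,−ε_i)`, `d_i(1,ε_j−ε_i)`, `∂_α(1,0)`, `∂_α(ξ_β,0)`,
`∂_α(1,ε_j)` and `d_0(1,0)`. -/
abbrev GenIdx (m n : ℕ) :=
  Fin m ⊕ (Fin m × Fin n) ⊕ (Fin m × Fin m) ⊕ Fin n ⊕ (Fin n × Fin n) ⊕
    (Fin n × Fin m) ⊕ Unit

/-- The generators of `L/J` as elements of `L` (with `b = true`). -/
def gens (m n : ℕ) : GenIdx m n → LAlg m n true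
  | .inl i => lsng (gl0, gl0, 0, .di i)
  | .inr (.inl (i, β)) => lsng (gl0, gOne β, 0, .di i)
  | .inr (.inr (.inl (i, j))) => lsng (gl0, gl0, natE j, .di i)
  | .inr (.inr (.inr (.inl α))) => lsng (gl0, gl0, 0, .pa α)
  | .inr (.inr (.inr (.inr (.inl (α, β))))) => lsng (gl0, gOne β, 0, .pa α)
  | .inr (.inr (.inr (.inr (.inr (.inl (α, j)))))) => lsng (gl0, gl0, natE j, .pa α)
  | .inr (.inr (.inr (.inr (.inr (.inr _))))) => lsng (gl0, gl0, 0, .d0)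

end

end WSuper

namespace WSuper

noncomputable section

variable {m n : ℕ}

/-- Bilinear extension of the bracket of `L`. -/
def lbr {b : Bool} (x y : LAlg m n b) : LAlg m n b :=
  x.sum fun bx cx => y.sum fun by' cy => (cx * cy) • lbb bx by'

/-- Index set for the standard basis `e_{xy}` of `gl(m,n)`. -/
abbrev GlIdx (m n : ℕ) := Fin m ⊕ Fin n

/-- Parity of an index of `gl(m,n)`. -/
def gpar : GlIdx m n → ℕ
  | .inl _ => 0
  | .inr _ => 1

/-- The copy of the standard basis of `gl(m,n)` inside `L` (modulo `J`):
`e_{ij} = d_j(1,ε_i−ε_j)`, `e_{αβ} = ∂_β(ξ_α,0) − ξ_α ∂_β(1,0)`,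
`e_{iβ} = ∂_β(1,ε_i)`, `e_{αj} = d_j(ξ_α,−ε_j) − ξ_α d_j(1,−ε_j)`. -/
def eEl : GlIdx m n → GlIdx m n → LAlg m n true
  | .inl i, .inl j => lsng (gl0, gl0, natE i, .di j)
  | .inr α, .inr β => lsng (gl0, gOne α, 0, .pa β) - lsng (gOne α, gl0, 0, .pa β)
  | .inl i, .inr β => lsng (gl0, gl0, natE i, .pa β)
  | .inr α, .inl j => lsng (gl0, gOne α, 0, .di j) - lsng (gOne α, gl0, 0, .di j)

/-- The central elements `d_i(1,−ε_i)` and `d_0(1,0)` of `L/J`. -/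
def cEl : Fin m ⊕ Unit → LAlg m n true
  | .inl i => lsng (gl0, gl0, 0, .di i)
  | .inr _ => lsng (gl0, gl0, 0, .d0)

/-- The elements `∂_α(1,0)` of `L`. -/
def pOneL (α : Fin n) : LAlg m n true := lsng (gl0, gl0, 0, .pa α)

end

/-! ### Structure constants of the exterior algebra -/

section Grassmann

variable {m n : ℕ}

/-- The sign bicharacter `(-1)^(number of inversions)` on Grassmann exponents. -/
def invSgn (s q : GExp n) : ℂ := (-1) ^ invCount s q

theorem invSgn_eq_prod (s q : GExp n) :
    invSgn s q = ∏ p : Fin n × Fin n,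
      if s p.1 = true ∧ q p.2 = true ∧ p.2 < p.1 then (-1 : ℂ) else 1 := by
  rw [invSgn, invCount, Finset.prod_ite]
  simp

theorem invSgn_xorE_left (s t q : GExp n) :
    invSgn (xorE s t) q = invSgn s q * invSgn t q := by
  simp only [invSgn_eq_prod, ← Finset.prod_mul_distrib]
  refine Finset.prod_congr rfl fun p _ => ?_
  cases hs : s p.1 <;> cases ht : t p.1 <;> by_cases hq : q p.2 = true ∧ p.2 < p.1 <;>
    simp [xorE, hs, ht, hq]

theorem invSgn_xorE_right (s q t : GExp n) :
    invSgn s (xorE q t) = invSgn s q * invSgn s t := by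
  simp only [invSgn_eq_prod, ← Finset.prod_mul_distrib]
  refine Finset.prod_congr rfl fun p _ => ?_
  cases hq : q p.2 <;> cases ht : t p.2 <;> by_cases hs : s p.1 = true ∧ p.2 < p.1 <;>
    simp_all [xorE]

theorem xorE_assoc (s t q : GExp n) : xorE (xorE s t) q = xorE s (xorE t q) := by
  funext a
  simp [xorE]

@[simp] theorem xorE_gl0_left (s : GExp n) : xorE gl0 s = s := by
  funext a
  simp [xorE, gl0]

@[simp] theorem xorE_gl0_right (s : GExp n) : xorE s gl0 = s := by
  funext a
  simp [xorE, gl0]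

@[simp] theorem mulSgn_gl0_left (s : GExp n) : mulSgn gl0 s = 1 := by
  simp [mulSgn, invCount, gl0]

@[simp] theorem mulSgn_gl0_right (s : GExp n) : mulSgn s gl0 = 1 := by
  simp [mulSgn, invCount, gl0]

@[simp] theorem derC_gl0 (a : Fin n) : derC a gl0 = 0 := by
  simp [derC, gl0]

theorem derC_gOne (a b : Fin n) : derC a (gOne b) = if a = b then 1 else 0 := by
  unfold derC gOne
  split_ifs with h1 h2 h2
  · have : (Finset.univ.filter fun x => decide (x = b) = true ∧ x < a) = ∅ := by
      ext x
      simp only [decide_eq_true_eq, Finset.mem_filter, Finset.mem_univ, true_and,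
        Finset.notMem_empty, iff_false, not_and]
      rintro rfl
      simp [h2]
    rw [this]
    simp
  · simp_all
  · simp_all
  · rfl

@[simp] theorem derE_gOne_self (a : Fin n) : derE a (gOne a) = gl0 := by
  funext x
  by_cases h : x = a <;> simp [derE, gOne, gl0, h]

@[simp] theorem gdeg_gl0 : gdeg (gl0 : GExp n) = 0 := by
  simp [gdeg, gl0]

@[simp] theorem gdeg_gOne (a : Fin n) : gdeg (gOne a) = 1 := by
  simp [gdeg, gOne, Finset.filter_eq']

/-- Associativity of the exterior algebra on monomials. -/
theorem mulSgn_assoc (s t q : GExp n) :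
    mulSgn s t * mulSgn (xorE s t) q = mulSgn t q * mulSgn s (xorE t q) := by
  by_cases h1 : ∃ a, s a = true ∧ t a = true
  · rw [mulSgn, if_pos h1, zero_mul]
    by_cases h2 : ∃ a, t a = true ∧ q a = true
    · rw [mulSgn, if_pos h2, zero_mul]
    · obtain ⟨a, ha⟩ := h1
      push Not at h2
      have h3 : ∃ a, s a = true ∧ xorE t q a = true := ⟨a, ha.1, by simp [xorE, ha.2, h2 a ha.2]⟩
      rw [mulSgn.eq_1 s, if_pos h3, mul_zero]
  · by_cases h2 : ∃ a, t a = true ∧ q a = true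
    · rw [mulSgn.eq_1 t, if_pos h2, zero_mul]
      obtain ⟨a, ha⟩ := h2
      push Not at h1
      have h3 : ∃ a, xorE s t a = true ∧ q a = true :=
        ⟨a, by
          have := h1 a
          cases hs : s a <;> simp_all [xorE], ha.2⟩
      rw [mulSgn.eq_1 (xorE s t), if_pos h3, mul_zero]
    · have h3 : (∃ a, xorE s t a = true ∧ q a = true) ↔ ∃ a, s a = true ∧ xorE t q a = true := by
        refine exists_congr fun a => ?_
        push Not at h1 h2
        have h1 := h1 a
        have h2 := h2 a
        cases hs : s a <;> cases ht : t a <;> cases hq : q a <;> simp_all [xorE]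
      simp only [mulSgn, if_neg h1, if_neg h2, h3]
      split_ifs
      · simp
      · have hl := invSgn_xorE_left s t q
        have hr := invSgn_xorE_right s t q
        simp only [invSgn] at hl hr
        rw [hl, hr]
        ring

theorem lmul_lm (s q : GExp n) : lmul (lm s) (lm q) = mulSgn s q • lm (xorE s q) := by
  rw [lmul, lm, lm, Finsupp.sum_single_index, Finsupp.sum_single_index] <;>
    simp [-Finsupp.smul_single]

@[simp] theorem lmul_zero (f : LamAlg n) : lmul f 0 = 0 := by
  simp [lmul]

end Grassmann

/-! ### Bilinearity of the `Λ`-module structure and of the bracket -/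

section Bilinear

variable {m n : ℕ} {b : Bool}

/-- The `Λ`-module structure of `L` as a bilinear map. -/
noncomputable def lmulLin : LamAlg n →ₗ[ℂ] LAlg m n b →ₗ[ℂ] LAlg m n b :=
  Finsupp.lsum ℂ fun e => LinearMap.toSpanSingleton ℂ _ <|
    Finsupp.lsum ℂ fun x => LinearMap.toSpanSingleton ℂ _ <|
      mulSgn e x.1 • lsng (xorE e x.1, x.2)

theorem lmulL_eq_lmulLin (h : LamAlg n) (z : LAlg m n b) :
    lmulL h z = lmulLin h z := by
  simp [lmulL, lmulLin, Finsupp.sum, smul_smul, Finset.smul_sum, LinearMap.sum_apply, lsng,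
    mul_assoc, -Finsupp.smul_single]

@[simp] theorem lmulLin_lm_lsng (e : GExp n) (x : LBasis m n b) :
    lmulLin (lm e) (lsng x) = mulSgn e x.1 • lsng (xorE e x.1, x.2) := by
  simp [lmulLin, lm, lsng]

/-- The bracket of `L` as a bilinear map. -/
noncomputable def lbrLin : LAlg m n b →ₗ[ℂ] LAlg m n b →ₗ[ℂ] LAlg m n b :=
  Finsupp.lsum ℂ fun x => LinearMap.toSpanSingleton ℂ _ <|
    Finsupp.lsum ℂ fun y => LinearMap.toSpanSingleton ℂ _ <| lbb x y

theorem lbr_eq_lbrLin (x y : LAlg m n b) : lbr x y = lbrLin x y := by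
  simp [lbr, lbrLin, Finsupp.sum, smul_smul, Finset.smul_sum, LinearMap.sum_apply]

@[simp] theorem lbrLin_lsng (x y : LBasis m n b) :
    lbrLin (lsng x) (lsng y) = lbb x y := by
  simp [lbrLin, lsng]

theorem lmulLin_lm_lmulLin_lm (e f : GExp n) (z : LAlg m n b) :
    lmulLin (lm e) (lmulLin (lm f) z) = mulSgn e f • lmulLin (lm (xorE e f)) z := by
  induction z using Finsupp.induction_linear with
  | zero => simp
  | add z w hz hw => simp only [map_add, hz, hw, smul_add]
  | single x c =>
    have hx : (Finsupp.single x c : LAlg m n b) = c • lsng x := by simp [lsng]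
    simp only [hx, map_smul, lmulLin_lm_lsng, smul_smul, xorE_assoc]
    congr 1
    linear_combination (-c) * mulSgn_assoc e f x.1

end Bilinear

/-! ### Brackets of the distinguished elements -/

section Brackets

variable {m n : ℕ}

@[simp] theorem natE_ne_zero (i : Fin m) : natE i ≠ 0 := fun h => by
  simpa [natE] using congrFun h i

theorem single_eq_lsng {b : Bool} (x : LBasis m n b) :
    (Finsupp.single x 1 : LAlg m n b) = lsng x := rfl

@[simp] theorem mkL_zOf {b : Bool} (a s : GExp n) (kk : Fin m → ℕ) (D : Dir m n b) :
    mkL a s (zOf kk D) D = lsng (a, s, kk, D) := by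
  simp [mkL, zOf, lsng]

@[simp] theorem zOf_pa {b : Bool} (kk : Fin m → ℕ) (α : Fin n) (i : Fin m) :
    zOf kk (Dir.pa α : Dir m n b) i = kk i := by
  simp [zOf, dsh]

@[simp] theorem zOf_d0 (kk : Fin m → ℕ) (i : Fin m) :
    zOf kk (Dir.d0 : Dir m n true) i = kk i := by
  simp [zOf, dsh]

theorem zOf_di {b : Bool} (kk : Fin m → ℕ) (j i : Fin m) :
    zOf kk (Dir.di j : Dir m n b) i = kk i - if j = i then 1 else 0 := by
  simp [zOf, dsh, @eq_comm _ i]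

@[simp] theorem zOf_pa_add {b : Bool} (α : Fin n) (D : Dir m n b) (k l : Fin m → ℕ) :
    zOf k (Dir.pa α : Dir m n b) + zOf l D = zOf (k + l) D := by
  funext x
  simp [zOf, dsh]
  ring

@[simp] theorem zOf_pa_sub {b : Bool} (α : Fin n) (k : Fin m → ℕ) (i : Fin m) :
    zOf k (Dir.pa α : Dir m n b) - epsZ i = zOf k (Dir.di i : Dir m n b) := by
  funext x
  simp only [zOf, dsh, epsZ, Pi.sub_apply, @eq_comm _ x]
  simp

@[simp] theorem zOf_natE_sub {b : Bool} (D : Dir m n b) (i : Fin m) :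
    zOf (natE i) D - epsZ i = zOf 0 D := by
  funext x
  simp [zOf, epsZ, natE]

@[simp] theorem zOf_di_add_natE {b : Bool} (D : Dir m n b) (k : Fin m → ℕ) (j : Fin m) :
    zOf k (Dir.di j : Dir m n b) + zOf (natE j) D = zOf k D := by
  funext x
  simp only [zOf, dsh, natE, Pi.add_apply, @eq_comm _ x]
  split_ifs <;> push_cast <;> ring

@[simp] theorem zOf_natE_add_di {b : Bool} (D : Dir m n b) (k : Fin m → ℕ) (j : Fin m) :
    zOf (natE j) D + zOf k (Dir.di j : Dir m n b) = zOf k D := by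
  rw [add_comm, zOf_di_add_natE]

@[simp] theorem mkL_zOf_pa {b : Bool} (a s : GExp n) (k : Fin m → ℕ) (α β : Fin n) :
    mkL a s (zOf k (Dir.pa α : Dir m n b)) (Dir.pa β : Dir m n b) = lsng (a, s, k, Dir.pa β) := by
  simp [mkL, zOf, lsng, dsh]

@[simp] theorem mkL_zOf_add_natE {b : Bool} (a s : GExp n) (k : Fin m → ℕ) (j : Fin m)
    (β : Fin n) :
    mkL a s (zOf (k + natE j) (Dir.di j : Dir m n b)) (Dir.pa β : Dir m n b) =
      lsng (a, s, k, Dir.pa β) := by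
  have h : zOf (k + natE j) (Dir.di j : Dir m n b) = zOf k (Dir.pa β : Dir m n b) := by
    funext x
    simp [zOf, dsh, natE, @eq_comm _ x]
  rw [h, mkL_zOf]

@[simp] theorem mkL_zOf_natE_add {b : Bool} (a s : GExp n) (k : Fin m → ℕ) (j : Fin m)
    (β : Fin n) :
    mkL a s (zOf (natE j + k) (Dir.di j : Dir m n b)) (Dir.pa β : Dir m n b) =
      lsng (a, s, k, Dir.pa β) := by
  rw [add_comm, mkL_zOf_add_natE]

@[simp] theorem zOf_natE_di_self {b : Bool} (j : Fin m) :
    zOf (natE j) (Dir.di j : Dir m n b) = 0 := by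
  funext x
  simp [zOf, dsh, natE, @eq_comm _ x]

@[simp] theorem mkL_zero_pa {b : Bool} (a s : GExp n) (β : Fin n) :
    mkL a s 0 (Dir.pa β : Dir m n b) = lsng (a, s, 0, Dir.pa β) := by
  have h : (0 : Fin m → ℤ) = zOf 0 (Dir.pa β : Dir m n b) := by
    funext x
    simp
  rw [h, mkL_zOf]

@[simp] theorem mkL_zero_di {b : Bool} (a s : GExp n) (j : Fin m) :
    mkL a s 0 (Dir.di j : Dir m n b) = lsng (a, s, natE j, Dir.di j) := by
  rw [← zOf_natE_di_self (n := n) (b := b) j, mkL_zOf]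

@[simp] theorem mkL_neg_epsZ {b : Bool} (a s : GExp n) (j : Fin m) :
    mkL a s (-epsZ j) (Dir.di j : Dir m n b) = lsng (a, s, 0, Dir.di j) := by
  rw [← zero_sub, ← zOf_natE_di_self (n := n) (b := b) j, zOf_natE_sub, mkL_zOf]

theorem natE_apply (i j : Fin m) : natE i j = if i = j then 1 else 0 := by
  simp [natE, eq_comm]

theorem lbr_cEl_lsng (z : Fin m ⊕ Unit) (y : LBasis m n true) :
    lbr (cEl z) (lsng y) = 0 := by
  obtain ⟨a, q, kk, D⟩ := y
  rw [lbr_eq_lbrLin]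
  cases z <;> cases D <;> simp [cEl, lbb, genBr, genOnL, lmulL_eq_lmulLin]

theorem lbr_pOneL_pOneL (α β : Fin n) : lbr (pOneL α : LAlg m n true) (pOneL β) = 0 := by
  simp [lbr_eq_lbrLin, pOneL, lbb, genBr, genOnL, lmulL_eq_lmulLin]

theorem lbr_pOneL_eEl (α : Fin n) (x y : GlIdx m n) :
    lbr (pOneL α : LAlg m n true) (eEl x y) = 0 := by
  rw [lbr_eq_lbrLin]
  rcases x with i | β <;> rcases y with j | γ
  iterate 2
    simp [pOneL, eEl, lbb, genBr, genOnL, lmulL_eq_lmulLin, single_eq_lsng]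
  all_goals
    obtain rfl | h := eq_or_ne α β
    · simp [pOneL, eEl, lbb, genBr, genOnL, lmulL_eq_lmulLin, single_eq_lsng, lpar, derC_gOne,
        lmul_lm]
    · simp [pOneL, eEl, lbb, genBr, genOnL, lmulL_eq_lmulLin, single_eq_lsng, lpar, derC_gOne,
        h]

theorem lbr_eEl_eEl (x y z w : GlIdx m n) :
    lbr (eEl x y) (eEl z w) = (if y = z then eEl x w else 0) -
      ((-1 : ℂ) ^ ((gpar x + gpar y) * (gpar z + gpar w))) • (if w = x then eEl z y else 0) := by
  rw [lbr_eq_lbrLin]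
  rcases x with i | α <;> rcases y with j | β <;> rcases z with k | γ <;> rcases w with l | δ <;>
  simp [eEl, lbb, genBr, genOnL, lmulL_eq_lmulLin, single_eq_lsng, lpar, lmul_lm,
    gpar, zOf_di, natE_apply, derC_gOne]
  all_goals split_ifs <;> subst_vars <;> simp_all [lmul_lm] <;> module

end Brackets

/-! ### The ideal `J` and generation of `L/J` -/

section Generation

variable {m n : ℕ} {b : Bool}

/-- Left multiplication by the monomial `ξ^e` on the weight space `U`. -/
noncomputable def lamU (e : GExp n) : UEx m n →ₗ[ℂ] UEx m n :=
  Finsupp.lsum ℂ fun u => LinearMap.toSpanSingleton ℂ _ <|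
    mulSgn e u.1 • (Finsupp.single (xorE e u.1, u.2) 1 : UEx m n)

@[simp] theorem lamU_single (e g : GExp n) (E : Dir m n false) :
    lamU e (Finsupp.single (g, E) 1) = mulSgn e g • Finsupp.single (xorE e g, E) 1 := by
  simp [lamU]

theorem lamU_lamU (e f : GExp n) (y : UEx m n) :
    lamU e (lamU f y) = mulSgn e f • lamU (xorE e f) y := by
  induction y using Finsupp.induction_linear with
  | zero => simp
  | add y z hy hz => simp only [map_add, hy, hz, smul_add]
  | single u c =>
    obtain ⟨g, E⟩ := u
    have hu : (Finsupp.single (g, E) c : UEx m n) = c • Finsupp.single (g, E) 1 := by simp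
    simp only [hu, map_smul, lamU_single, smul_smul, xorE_assoc]
    congr 1
    linear_combination (-c) * mulSgn_assoc e f g

theorem exActL_lsng_single (r : LExp m) (l0 : ℂ) (x : LBasis m n b) (u : UExB m n) :
    exActL r l0 (lsng x) (Finsupp.single u 1) =
      lamU x.1 (exGen r l0 x.2.1 x.2.2.1 x.2.2.2 u) := by
  simp [exActL, exActB, exActVal, lamU, lsng, Finsupp.sum, smul_smul, -Finsupp.smul_single]

theorem mem_Jsub {v : LAlg m n b} :
    v ∈ Jsub m n b ↔
      ∀ (r : LExp m) (l0 : ℂ) (u : UExB m n), exActL r l0 v (Finsupp.single u 1) = 0 := by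
  simp only [Jsub, Submodule.mem_iInf, LinearMap.mem_ker]
  refine forall₂_congr fun r l0 => ⟨fun h u => by rw [h, LinearMap.zero_apply], fun h => ?_⟩
  ext u : 2
  simpa using h u

theorem exActL_lmulLin (r : LExp m) (l0 : ℂ) (e : GExp n) (v : LAlg m n b)
    (u : UExB m n) :
    exActL r l0 (lmulLin (lm e) v) (Finsupp.single u 1) =
      lamU e (exActL r l0 v (Finsupp.single u 1)) := by
  induction v using Finsupp.induction_linear with
  | zero => simp
  | add v w hv hw => simp only [map_add, LinearMap.add_apply, hv, hw]
  | single x c =>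
    have hx : (Finsupp.single x c : LAlg m n b) = c • lsng x := by simp [lsng]
    simp only [hx, map_smul, LinearMap.smul_apply, lmulLin_lm_lsng, exActL_lsng_single, lamU_lamU]

theorem lmulLin_mem_Jsub (e : GExp n) {v : LAlg m n b} (hv : v ∈ Jsub m n b) :
    lmulLin (lm e) v ∈ Jsub m n b := by
  rw [mem_Jsub] at hv ⊢
  intro r l0 u
  rw [exActL_lmulLin, hv, map_zero]

theorem lsng_mem_Jsub_of_ne (s : GExp n) {k : Fin m → ℕ} (hk : k ≠ 0)
    (hkE : ∀ j, k ≠ natE j) (D : Dir m n b) : lsng (gl0, s, k, D) ∈ Jsub m n b := by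
  rw [mem_Jsub]
  rintro r l0 ⟨g, E⟩
  rw [exActL_lsng_single]
  cases D <;> cases E <;> simp [exGen, hk, hkE]

theorem lsng_sub_mem_Jsub_of_ne (s : GExp n) {k : Fin m → ℕ} (hk : k ≠ 0)
    (D : Dir m n b) : lsng (gl0, s, k, D) - lsng (s, gl0, k, D) ∈ Jsub m n b := by
  rw [mem_Jsub]
  rintro r l0 ⟨g, E⟩
  rw [map_sub, LinearMap.sub_apply, exActL_lsng_single, exActL_lsng_single]
  cases D <;> cases E <;> simp [exGen, hk, -Finsupp.smul_single]
  all_goals split_ifs <;> simp [smul_smul, -Finsupp.smul_single]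

theorem lsng_d0_mem_Jsub (s : GExp n) {k : Fin m → ℕ} (hk : k ≠ 0) :
    lsng (gl0, s, k, (Dir.d0 : Dir m n true)) ∈ Jsub m n true := by
  rw [mem_Jsub]
  rintro r l0 ⟨g, E⟩
  rw [exActL_lsng_single]
  simp [exGen, hk]

theorem lsng_d0_sub_mem_Jsub (s : GExp n) :
    lsng (gl0, s, 0, (Dir.d0 : Dir m n true)) - lsng (s, gl0, 0, Dir.d0) ∈ Jsub m n true := by
  rw [mem_Jsub]
  rintro r l0 ⟨g, E⟩
  rw [map_sub, LinearMap.sub_apply, exActL_lsng_single, exActL_lsng_single]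
  simp [exGen, smul_smul, -Finsupp.smul_single]

theorem lsng_di_sub_mem_Jsub (s : GExp n) (i : Fin m) :
    lsng (gl0, s, 0, (Dir.di i : Dir m n true)) - lsng (s, gl0, 0, Dir.di i) -
      ∑ α : Fin n, ((-1 : ℂ) ^ (gdeg s + 1) * derC α s) •
        lmulLin (lm (derE α s)) (eEl (.inr α) (.inl i)) ∈ Jsub m n true := by
  rw [mem_Jsub]
  rintro r l0 ⟨g, E⟩
  simp only [map_sub, map_sum, map_smul, LinearMap.sub_apply, LinearMap.sum_apply,
    LinearMap.smul_apply, exActL_lmulLin, exActL_lsng_single, eEl]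
  cases E
  · simp [exGen, smul_smul, -Finsupp.smul_single]
  · rename_i γ
    simp only [exGen, derC_gOne, if_true]
    rw [Finset.sum_eq_single γ]
    · simp [smul_smul, -Finsupp.smul_single]
      module
    · intro x _ hx
      simp [hx.symm, smul_smul, -Finsupp.smul_single]
    · simp

theorem lsng_pa_sub_mem_Jsub (s : GExp n) (β : Fin n) :
    lsng (gl0, s, 0, (Dir.pa β : Dir m n true)) - lsng (s, gl0, 0, Dir.pa β) -
      ∑ α : Fin n, ((-1 : ℂ) ^ (gdeg s + 1) * derC α s) •
        lmulLin (lm (derE α s)) (eEl (.inr α) (.inr β)) ∈ Jsub m n true := by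
  rw [mem_Jsub]
  rintro r l0 ⟨g, E⟩
  simp only [map_sub, map_sum, map_smul, LinearMap.sub_apply, LinearMap.sum_apply,
    LinearMap.smul_apply, exActL_lmulLin, exActL_lsng_single, eEl]
  cases E
  · simp [exGen, smul_smul, -Finsupp.smul_single]
  · rename_i γ
    simp only [exGen, derC_gOne, if_true]
    rw [Finset.sum_eq_single γ]
    · simp [smul_smul, -Finsupp.smul_single]
      module
    · intro x _ hx
      simp [hx.symm, smul_smul, -Finsupp.smul_single]
    · simp

/-- The generators of the three families, as one family. -/
noncomputable def famEl : (Fin m ⊕ Unit) ⊕ Fin n ⊕ GlIdx m n × GlIdx m n → LAlg m n true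
  | .inl z => cEl z
  | .inr (.inl α) => pOneL α
  | .inr (.inr p) => eEl p.1 p.2

/-- The `Λ`-linear combination of the generators with given coefficients. -/
noncomputable def famComb (m n : ℕ) :
    ((Fin m ⊕ Unit) ⊕ Fin n ⊕ GlIdx m n × GlIdx m n → LamAlg n) →ₗ[ℂ] LAlg m n true :=
  ∑ i, (lmulLin (b := true)).flip (famEl i) ∘ₗ LinearMap.proj i

theorem famComb_apply (c : (Fin m ⊕ Unit) ⊕ Fin n ⊕ GlIdx m n × GlIdx m n → LamAlg n) :
    famComb m n c = ∑ i, lmulLin (c i) (famEl i) := by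
  simp [famComb, LinearMap.sum_apply]

/-- The preimage in `L` of the `Λ`-submodule of `L/J` generated by the three families. -/
noncomputable def genSpan (m n : ℕ) : Submodule ℂ (LAlg m n true) :=
  Jsub m n true ⊔ LinearMap.range (famComb m n)

theorem lmulLin_famEl_mem (f : LamAlg n)
    (i : (Fin m ⊕ Unit) ⊕ Fin n ⊕ GlIdx m n × GlIdx m n) :
    lmulLin f (famEl i) ∈ genSpan m n := by
  refine Submodule.mem_sup_right ⟨Pi.single i f, ?_⟩
  rw [famComb_apply, Finset.sum_eq_single i]
  · simp
  · intro j _ hj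
    simp [hj]
  · simp

theorem mem_genSpan_of_sub_mem {v w : LAlg m n true} (h : v - w ∈ Jsub m n true)
    (hw : w ∈ genSpan m n) : v ∈ genSpan m n := by
  have hvw : v - w ∈ genSpan m n := Submodule.mem_sup_left h
  exact (Submodule.sub_mem_iff_left _ hw).1 hvw

theorem lmulLin_mem_genSpan (e : GExp n) {v : LAlg m n true} (hv : v ∈ genSpan m n) :
    lmulLin (lm e) v ∈ genSpan m n := by
  obtain ⟨w, hw, _, ⟨c, rfl⟩, rfl⟩ := Submodule.mem_sup.1 hv
  rw [map_add, famComb_apply, map_sum]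
  refine add_mem (Submodule.mem_sup_left (lmulLin_mem_Jsub e hw)) (sum_mem fun i _ => ?_)
  induction c i using Finsupp.induction_linear with
  | zero => simp
  | add f g hf hg => simpa only [map_add, LinearMap.add_apply] using add_mem hf hg
  | single s a =>
    have hs : (Finsupp.single s a : LamAlg n) = a • lm s := by simp [lm]
    rw [hs, map_smul, LinearMap.smul_apply, map_smul, lmulLin_lm_lmulLin_lm]
    exact Submodule.smul_mem _ _ (Submodule.smul_mem _ _ (lmulLin_famEl_mem _ i))

theorem lsng_gl0_eq_lmulLin (s : GExp n) (k : Fin m → ℕ) (D : Dir m n b) :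
    lsng (s, gl0, k, D) = lmulLin (lm s) (lsng (gl0, gl0, k, D)) := by
  simp

theorem lsng_gl0_left_mem_genSpan (s : GExp n) (k : Fin m → ℕ) (D : Dir m n true) :
    lsng (gl0, s, k, D) ∈ genSpan m n := by
  have hE (f : GExp n) (x y : GlIdx m n) : lmulLin (lm f) (eEl x y) ∈ genSpan m n :=
    lmulLin_famEl_mem (lm f) (.inr (.inr (x, y)))
  by_cases hk : k = 0
  · subst hk
    cases D with
    | di i =>
      have h := lsng_di_sub_mem_Jsub s i
      rw [sub_sub] at h
      refine mem_genSpan_of_sub_mem h (add_mem ?_ ?_)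
      · rw [lsng_gl0_eq_lmulLin]
        exact lmulLin_famEl_mem (lm s) (.inl (.inl i))
      · exact sum_mem fun α _ => Submodule.smul_mem _ _ (hE _ _ _)
    | pa β =>
      have h := lsng_pa_sub_mem_Jsub (m := m) s β
      rw [sub_sub] at h
      refine mem_genSpan_of_sub_mem h (add_mem ?_ ?_)
      · rw [lsng_gl0_eq_lmulLin]
        exact lmulLin_famEl_mem (lm s) (.inr (.inl β))
      · exact sum_mem fun α _ => Submodule.smul_mem _ _ (hE _ _ _)
    | d0 =>
      refine mem_genSpan_of_sub_mem (lsng_d0_sub_mem_Jsub s) ?_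
      rw [lsng_gl0_eq_lmulLin]
      exact lmulLin_famEl_mem (lm s) (.inl (.inr ()))
  · by_cases hkE : ∃ j, k = natE j
    · obtain ⟨j, rfl⟩ := hkE
      cases D with
      | d0 => exact Submodule.mem_sup_left (lsng_d0_mem_Jsub s hk)
      | di i =>
        refine mem_genSpan_of_sub_mem (lsng_sub_mem_Jsub_of_ne s hk _) ?_
        rw [lsng_gl0_eq_lmulLin]
        exact hE s (.inl j) (.inl i)
      | pa β =>
        refine mem_genSpan_of_sub_mem (lsng_sub_mem_Jsub_of_ne s hk _) ?_
        rw [lsng_gl0_eq_lmulLin]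
        exact hE s (.inl j) (.inr β)
    · exact Submodule.mem_sup_left (lsng_mem_Jsub_of_ne s hk (not_exists.1 hkE) D)

theorem genSpan_eq_top : genSpan m n = ⊤ := by
  refine eq_top_iff.2 fun v _ => ?_
  induction v using Finsupp.induction_linear with
  | zero => exact zero_mem _
  | add v w hv hw => exact add_mem (hv trivial) (hw trivial)
  | single x c =>
    obtain ⟨a, s, k, D⟩ := x
    have hx : (Finsupp.single (a, s, k, D) c : LAlg m n true) =
        c • lmulLin (lm a) (lsng (gl0, s, k, D)) := by
      rw [lmulLin_lm_lsng, mulSgn_gl0_right, one_smul, xorE_gl0_right]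
      simp [lsng]
    rw [hx]
    exact Submodule.smul_mem _ _ (lmulLin_mem_genSpan a (lsng_gl0_left_mem_genSpan s k D))

end Generation

/-- As a `Λ`-module, the quotient Lie superalgebra `L/J` is
generated by three supercommuting subalgebras: (1) the central ideal spanned by
`{d_i(1,−ε_i), d_0(1,0)}`; (2) the abelian subalgebra spanned by `{∂_α(1,0)}`;
and (3) a subalgebra isomorphic to `gl(m,n)` spanned by the elements `e_{xy}`.
(All identities are phrased inside `L`, modulo the ideal `J`.) -/
theorem quotient_three_subalgebras (m n : ℕ) :
    -- (1) the elements `d_i(1,−ε_i)`, `d_0(1,0)` are central in `L/J`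
    (∀ (z : Fin m ⊕ Unit) (y : LBasis m n true),
      lbr (cEl z) (lsng y) ∈ Jsub m n true) ∧
    -- (2) the elements `∂_α(1,0)` span an abelian (odd) subalgebra of `L/J`
    (∀ α β : Fin n, lbr (pOneL α) (pOneL β) ∈ Jsub m n true) ∧
    -- (2') which supercommutes with the `gl(m,n)`-subalgebra
    (∀ (α : Fin n) (x y : GlIdx m n),
      lbr (pOneL α : LAlg m n true) (eEl x y) ∈ Jsub m n true) ∧
    -- (3) the elements `e_{xy}` satisfy the `gl(m,n)` relations modulo `J`
    (∀ x y z w : GlIdx m n,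
      lbr (eEl x y) (eEl z w)
          - ((if y = z then eEl x w else 0)
            - ((-1 : ℂ) ^ ((gpar x + gpar y) * (gpar z + gpar w))) •
                (if w = x then eEl z y else 0)) ∈ Jsub m n true) ∧
    -- `L/J` is generated by these three families as a `Λ`-module
    (∀ v : LAlg m n true,
      ∃ (c1 : Fin m ⊕ Unit → LamAlg n) (c2 : Fin n → LamAlg n)
        (c3 : GlIdx m n × GlIdx m n → LamAlg n),
        v - (∑ z : Fin m ⊕ Unit, lmulL (c1 z) (cEl z))
          - (∑ α : Fin n, lmulL (c2 α) (pOneL α))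
          - (∑ p : GlIdx m n × GlIdx m n, lmulL (c3 p) (eEl p.1 p.2))
          ∈ Jsub m n true) := by
  refine ⟨fun z y => ?_, fun α β => ?_, fun α x y => ?_, fun x y z w => ?_, fun v => ?_⟩
  · rw [lbr_cEl_lsng]
    exact zero_mem _
  · rw [lbr_pOneL_pOneL]
    exact zero_mem _
  · rw [lbr_pOneL_eEl]
    exact zero_mem _
  · rw [lbr_eEl_eEl, sub_self]
    exact zero_mem _
  · have hv : v ∈ genSpan m n := genSpan_eq_top ▸ Submodule.mem_top
    obtain ⟨w, hw, _, ⟨c, rfl⟩, rfl⟩ := Submodule.mem_sup.1 hv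
    refine ⟨fun z => c (.inl z), fun α => c (.inr (.inl α)), fun p => c (.inr (.inr p)), ?_⟩
    convert hw using 1
    simp only [lmulL_eq_lmulLin, famComb_apply, Fintype.sum_sum_type, famEl]
    abel

end WSuper
end
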